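/- (Representation "B", case 1.) Let ρ > 1/2 and let μ ∈ ℂ with Re μ < 1 + 1/ρ. Let δ₁, δ₂ be real numbers satisfying: π/(2ρ) < δ₁ ≤ π/ρ and π/(2ρ) < δ₂ ≤ π/ρ if ρ > 1; π/(2ρ) < δ₁ < π and π/(2ρ) < δ₂ < π if 1/2 < ρ ≤ 1. Let z = R·exp(iθ) with R > 0 and π/(2ρ) − δ₂ + π < θ < −π/(2ρ) + δ₁ + π. Then E_{ρ,μ}(z) = ∫_{0}^{∞} K_{ρ,μ}(r, −δ₁, δ₂, z) dr. -/

import Mathlib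

open scoped Real
open MeasureTheory intervalIntegral

/-- The two-parameter Mittag-Leffler function
`E_{ρ,μ}(z) = ∑_{k=0}^∞ z^k / Γ(μ + k/ρ)`. -/
noncomputable def ML (ρ : ℝ) (μ z : ℂ) : ℂ :=
  ∑' k : ℕ, z ^ k * (Complex.Gamma (μ + (k : ℂ) / (ρ : ℂ)))⁻¹

/-- `φ_{ρ,μ}(ζ,z) = (ρ/(2πi)) exp((ζz)^ρ) (ζz)^{ρ(1-μ)}` at `ζ = r e^{iφ}`,
on the branch fixed by `arg z = θ`, `z = R e^{iθ}`. -/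
noncomputable def phiFun (ρ : ℝ) (μ : ℂ) (R θ r φ : ℝ) : ℂ :=
  ((ρ : ℂ) / (2 * (π : ℂ) * Complex.I)) *
    Complex.exp (Complex.exp ((ρ : ℂ) * ((Real.log (R * r) : ℂ) + Complex.I * ((θ + φ : ℝ) : ℂ)))) *
    Complex.exp ((ρ : ℂ) * (1 - μ) * ((Real.log (R * r) : ℂ) + Complex.I * ((θ + φ : ℝ) : ℂ)))

/-- The (complex-valued) phase function `η(r,φ)`. -/
noncomputable def etaF (ρ : ℝ) (μ : ℂ) (R θ r φ : ℝ) : ℂ :=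
  Complex.exp ((ρ : ℂ) * ((Real.log (R * r) : ℂ) + Complex.I * ((θ - π : ℝ) : ℂ))) *
      Complex.sin ((ρ : ℂ) * (φ : ℂ)) +
    (ρ : ℂ) * (1 - μ) * (φ : ℂ)

/-- The function `A_{ρ,μ}(r,ω₁,ω₂,z)`. -/
noncomputable def AF (ρ : ℝ) (μ : ℂ) (R θ r ω₁ ω₂ : ℝ) : ℂ :=
  Complex.exp (Complex.exp ((ρ : ℂ) * ((Real.log (R * r) : ℂ) + Complex.I * ((θ - π : ℝ) : ℂ))) *
      Complex.cos ((ρ : ℂ) * (ω₁ : ℂ))) *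
    ((r ^ 2 + 2 * r * Real.cos ω₂ + 1 : ℝ) : ℂ) *
    Complex.exp (Complex.I * etaF ρ μ R θ r ω₁) *
    ((r : ℂ) + Complex.exp (Complex.I * (ω₁ : ℂ)))

/-- The kernel `K_{ρ,μ}(r,φ₁,φ₂,z)`. -/
noncomputable def KF (ρ : ℝ) (μ : ℂ) (R θ r φ₁ φ₂ : ℝ) : ℂ :=
  ((ρ : ℂ) / (2 * (π : ℂ) * Complex.I)) *
    Complex.exp ((ρ : ℂ) * (1 - μ) * ((Real.log (R * r) : ℂ) + Complex.I * (θ : ℂ))) *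
    Complex.exp (-(Complex.I * (ρ : ℂ) * (π : ℂ) * (1 - μ))) *
    (AF ρ μ R θ r φ₂ φ₁ - AF ρ μ R θ r φ₁ φ₂) /
    (((r ^ 2 + 2 * r * Real.cos φ₁ + 1 : ℝ) : ℂ) * ((r ^ 2 + 2 * r * Real.cos φ₂ + 1 : ℝ) : ℂ))

/-- The (complex-valued) phase function `χ(r,φ)`. -/
noncomputable def chiF (ρ : ℝ) (μ : ℂ) (R θ r φ : ℝ) : ℂ :=
  Complex.exp ((ρ : ℂ) * ((Real.log (R * r) : ℂ) + Complex.I * (θ : ℂ))) *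
      Complex.sin ((ρ : ℂ) * (φ : ℂ)) +
    (ρ : ℂ) * (1 - μ) * (φ : ℂ)

/-- The kernel `P_{ρ,μ}(r,φ,z)`. -/
noncomputable def PF (ρ : ℝ) (μ : ℂ) (R θ r φ : ℝ) : ℂ :=
  ((ρ : ℂ) / (2 * (π : ℂ))) *
    Complex.exp (Complex.exp ((ρ : ℂ) * ((Real.log (R * r) : ℂ) + Complex.I * (θ : ℂ))) *
      Complex.cos ((ρ : ℂ) * (φ : ℂ))) *
    Complex.exp ((ρ : ℂ) * (1 - μ) * ((Real.log (R * r) : ℂ) + Complex.I * (θ : ℂ))) *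
    Complex.exp (Complex.I * chiF ρ μ R θ r φ) *
    ((r : ℂ) * ((r : ℂ) - Complex.exp (Complex.I * (φ : ℂ)))) /
    ((r ^ 2 - 2 * r * Real.cos φ + 1 : ℝ) : ℂ)

/-- The symmetric kernel `K_{ρ,μ}(r,φ,z)` (case `δ₁ρ = δ₂ρ`). -/
noncomputable def KsymF (ρ : ℝ) (μ : ℂ) (R θ r φ : ℝ) : ℂ :=
  ((ρ : ℂ) / (π : ℂ)) *
    Complex.exp ((ρ : ℂ) * (1 - μ) * ((Real.log (R * r) : ℂ) + Complex.I * ((θ - π : ℝ) : ℂ))) *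
    Complex.exp (Complex.exp ((ρ : ℂ) * ((Real.log (R * r) : ℂ) + Complex.I * ((θ - π : ℝ) : ℂ))) *
      Complex.cos ((ρ : ℂ) * (φ : ℂ))) *
    ((r : ℂ) * Complex.sin (etaF ρ μ R θ r φ) + Complex.sin (etaF ρ μ R θ r φ + (φ : ℂ))) /
    ((r ^ 2 + 2 * r * Real.cos φ + 1 : ℝ) : ℂ)

/-- The kernel `K_{ρ,μ}(r,z)` (case `δρ = π/ρ`). -/
noncomputable def KpiF (ρ : ℝ) (μ : ℂ) (R θ r : ℝ) : ℂ :=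
  ((ρ : ℂ) / (π : ℂ)) *
    Complex.exp ((ρ : ℂ) * (1 - μ) * ((Real.log (R * r) : ℂ) + Complex.I * ((θ - π : ℝ) : ℂ))) *
    Complex.exp (-Complex.exp ((ρ : ℂ) * ((Real.log (R * r) : ℂ) + Complex.I * ((θ - π : ℝ) : ℂ)))) *
    ((r : ℂ) * Complex.sin ((π : ℂ) * (1 - μ)) +
      Complex.sin ((π : ℂ) * (1 - μ) + (π : ℂ) / (ρ : ℂ))) /
    ((r ^ 2 + 2 * r * Real.cos (π / ρ) + 1 : ℝ) : ℂ)

/-- The kernel `K′_{ρ,μ}(r,φ,z)`. -/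
noncomputable def KpF (ρ : ℝ) (μ : ℂ) (R θ r φ : ℝ) : ℂ :=
  ((ρ : ℂ) / (2 * (π : ℂ) * Complex.I)) *
    Complex.exp (Complex.exp ((ρ : ℂ) * ((Real.log (R * r) : ℂ) + Complex.I * ((θ - π : ℝ) : ℂ))) *
      Complex.cos ((ρ : ℂ) * (φ : ℂ))) *
    Complex.exp ((ρ : ℂ) * (1 - μ) * ((Real.log (R * r) : ℂ) + Complex.I * (θ : ℂ))) *
    Complex.exp (Complex.I * (etaF ρ μ R θ r φ - (π : ℂ) * (ρ : ℂ) * (1 - μ))) *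
    ((r : ℂ) + Complex.exp (Complex.I * (φ : ℂ))) /
    ((r ^ 2 + 2 * r * Real.cos φ + 1 : ℝ) : ℂ)

/-- `r(τ,ψ) = √(τ² + 2τ cos ψ + 1)`. -/
noncomputable def rP (τ ψ : ℝ) : ℝ := Real.sqrt (τ ^ 2 + 2 * τ * Real.cos ψ + 1)

/-- `φ(τ,ψ,k) = arctan(τ sin ψ / (τ cos ψ + 1)) + kπ`. -/
noncomputable def phiP (τ ψ : ℝ) (k : ℤ) : ℝ :=
  Real.arctan (τ * Real.sin ψ / (τ * Real.cos ψ + 1)) + k * π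

/-- The (complex-valued) phase `χ′(τ,ψ,k,z)`. -/
noncomputable def chiP (ρ : ℝ) (μ : ℂ) (R θ τ ψ : ℝ) (k : ℤ) : ℂ :=
  Complex.exp ((ρ : ℂ) * ((Real.log (R * rP τ ψ) : ℂ) + Complex.I * (θ : ℂ))) *
      Complex.sin ((ρ : ℂ) * (phiP τ ψ k : ℂ)) +
    (ρ : ℂ) * (1 - μ) * (phiP τ ψ k : ℂ)

/-- The kernel `P′_{ρ,μ}(τ,ψ,k,z)`. -/
noncomputable def PpF (ρ : ℝ) (μ : ℂ) (R θ τ ψ : ℝ) (k : ℤ) : ℂ :=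
  ((ρ * τ : ℝ) : ℂ) / (2 * (π : ℂ)) *
    Complex.exp (Complex.exp ((ρ : ℂ) * ((Real.log (R * rP τ ψ) : ℂ) + Complex.I * (θ : ℂ))) *
      Complex.cos ((ρ : ℂ) * (phiP τ ψ k : ℂ))) *
    Complex.exp ((ρ : ℂ) * (1 - μ) * ((Real.log (R * rP τ ψ) : ℂ) + Complex.I * (θ : ℂ))) *
    Complex.exp (Complex.I * (chiP ρ μ R θ τ ψ k + (ψ : ℂ))) *
    ((rP τ ψ : ℂ) * Complex.exp (-(Complex.I * (phiP τ ψ k : ℂ))) - 1) /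
    ((rP τ ψ ^ 2 - 2 * rP τ ψ * Real.cos (phiP τ ψ k) + 1 : ℝ) : ℂ)

section HankelContour

open Set Filter Topology
open scoped Interval

/-- The integrand `exp (e ^ v + (1 - s) v)` of Hankel's integral for `1 / Γ(s)`, in the
logarithmic variable `v = log u`. -/
noncomputable def hankelKernel (s v : ℂ) : ℂ := Complex.exp (Complex.exp v + (1 - s) * v)

/-- The integral of `F` along the contour that comes in from `+∞ + i b₁` to `X + i b₁`, goes
up to `X + i b₂`, and returns to `+∞ + i b₂`. -/
noncomputable def hankelIntegral (b₁ b₂ X : ℝ) (F : ℂ → ℂ) : ℂ :=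
  (∫ x in Ioi X, (F (x + b₂ * Complex.I) - F (x + b₁ * Complex.I))) +
    Complex.I * ∫ y in b₁..b₂, F (X + y * Complex.I)

theorem norm_hankelKernel (s : ℂ) (x b : ℝ) :
    ‖hankelKernel s (x + b * Complex.I)‖ =
      Real.exp (Real.exp x * Real.cos b + (1 - s.re) * x + s.im * b) := by
  rw [hankelKernel, Complex.norm_exp]
  congr 1
  simp [Complex.exp_re]
  ring

theorem continuous_hankelKernel_uncurry :
    Continuous fun p : ℂ × ℂ ↦ hankelKernel p.1 p.2 := by
  unfold hankelKernel
  fun_prop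

@[fun_prop]
theorem continuous_hankelKernel (s : ℂ) : Continuous (hankelKernel s) := by
  unfold hankelKernel
  fun_prop

@[fun_prop]
theorem differentiable_hankelKernel (s : ℂ) : Differentiable ℂ (hankelKernel s) := by
  unfold hankelKernel
  fun_prop

theorem hankelKernel_add (s a v : ℂ) :
    hankelKernel (s + a) v = Complex.exp (-(a * v)) * hankelKernel s v := by
  rw [hankelKernel, hankelKernel, ← Complex.exp_add]
  ring_nf

theorem hasDerivAt_hankelKernel (s v : ℂ) :
    HasDerivAt (hankelKernel (s + 1)) (hankelKernel s v - s * hankelKernel (s + 1) v) v := by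
  have h := ((Complex.hasDerivAt_exp v).add ((hasDerivAt_id v).const_mul (1 - (s + 1)))).cexp
  refine HasDerivAt.congr_deriv h ?_
  have : hankelKernel s v = Complex.exp v * hankelKernel (s + 1) v := by
    rw [hankelKernel_add, ← mul_assoc, ← Complex.exp_add]
    simp
  rw [this, hankelKernel]
  simp
  ring

theorem integral_comp_exp (g : ℝ → ℂ) :
    ∫ x : ℝ, Real.exp x • g (Real.exp x) = ∫ u in Ioi (0 : ℝ), g u := by
  symm
  rw [← Real.range_exp, ← image_univ]
  simpa [abs_of_pos (Real.exp_pos _)] using integral_image_eq_integral_abs_deriv_smul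
    MeasurableSet.univ (fun x _ ↦ (Real.hasDerivAt_exp x).hasDerivWithinAt)
    Real.exp_injective.injOn g

theorem integrable_comp_exp_iff (g : ℝ → ℝ) :
    Integrable (fun x ↦ Real.exp x • g (Real.exp x)) ↔ IntegrableOn g (Ioi 0) := by
  symm
  rw [← Real.range_exp, ← image_univ]
  simpa [abs_of_pos (Real.exp_pos _)] using integrableOn_image_iff_integrableOn_abs_deriv_smul
    MeasurableSet.univ (fun x _ ↦ (Real.hasDerivAt_exp x).hasDerivWithinAt)
    Real.exp_injective.injOn g

theorem integrable_hankelKernel {s : ℂ} {b : ℝ} (hs : s.re < 1) (hb : Real.cos b < 0) :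
    Integrable fun x : ℝ ↦ hankelKernel s (x + b * Complex.I) := by
  have h := (integrable_comp_exp_iff _).2 (integrableOn_rpow_mul_exp_neg_mul_rpow
    (show -1 < -s.re by linarith) one_pos (neg_pos.2 hb))
  refine (h.const_mul (Real.exp (s.im * b))).mono' (by fun_prop) (ae_of_all _ fun x ↦ ?_)
  rw [norm_hankelKernel, ← Real.exp_mul, smul_eq_mul, ← Real.exp_add, ← Real.exp_add,
    ← Real.exp_add, Real.rpow_one]
  refine Real.exp_le_exp.2 (le_of_eq ?_)
  ring

theorem integrableOn_hankelKernel (s : ℂ) (X : ℝ) {b : ℝ} (hb : Real.cos b < 0) :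
    IntegrableOn (fun x : ℝ ↦ hankelKernel s (x + b * Complex.I)) (Ioi X) := by
  obtain ⟨a, ha₀, ha⟩ : ∃ a : ℝ, 0 ≤ a ∧ s.re - a < 1 :=
    ⟨|s.re|, abs_nonneg _, by linarith [le_abs_self s.re]⟩
  have h := integrable_hankelKernel (s := s + (-a : ℝ))
    (by simpa [← sub_eq_add_neg] using ha) hb
  refine (h.norm.const_mul (Real.exp (-(a * X)))).integrableOn.mono' (by fun_prop) ?_
  filter_upwards [ae_restrict_mem measurableSet_Ioi] with x hx
  rw [norm_hankelKernel, norm_hankelKernel, ← Real.exp_add]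
  refine Real.exp_le_exp.2 ?_
  simp
  nlinarith [mul_le_mul_of_nonneg_left (le_of_lt (show X < x from hx)) ha₀]

/-- Cauchy's theorem on a rectangle. -/
theorem intervalIntegral_sub_eq_of_differentiableOn_strip {F : ℂ → ℂ} {b₁ b₂ : ℝ}
    (hF : DifferentiableOn ℂ F {v | v.im ∈ [[b₁, b₂]]}) (a X : ℝ) :
    ∫ x in a..X, (F (x + b₂ * Complex.I) - F (x + b₁ * Complex.I)) =
      Complex.I * (∫ y in b₁..b₂, F (X + y * Complex.I)) -
        Complex.I * ∫ y in b₁..b₂, F (a + y * Complex.I) := by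
  have hline : ∀ b ∈ [[b₁, b₂]], Continuous fun x : ℝ ↦ F (x + b * Complex.I) := fun b hb ↦
    hF.continuousOn.comp_continuous (by fun_prop) fun x ↦ by simpa using hb
  have h := Complex.integral_boundary_rect_eq_zero_of_differentiableOn F
    (a + b₁ * Complex.I) (X + b₂ * Complex.I) (hF.mono fun v hv ↦ by simpa using hv.2)
  simp at h
  rw [intervalIntegral.integral_sub ((hline _ right_mem_uIcc).intervalIntegrable _ _)
    ((hline _ left_mem_uIcc).intervalIntegrable _ _)]
  linear_combination -h

theorem tendsto_vertical_integral_zero {F : ℂ → ℂ} {b₁ b₂ : ℝ} {l : Filter ℝ} {B : ℝ → ℝ}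
    (hB : Tendsto B l (𝓝 0)) (hF : ∀ x : ℝ, ∀ y ∈ [[b₁, b₂]], ‖F (x + y * Complex.I)‖ ≤ B x) :
    Tendsto (fun x : ℝ ↦ Complex.I * ∫ y in b₁..b₂, F (x + y * Complex.I)) l (𝓝 0) := by
  refine squeeze_zero_norm (a := fun x ↦ B x * |b₂ - b₁|) (fun x ↦ ?_)
    (by simpa using hB.mul_const |b₂ - b₁|)
  rw [norm_mul, Complex.norm_I, one_mul]
  exact intervalIntegral.norm_integral_le_of_norm_le_const fun y hy ↦
    hF x y (uIoc_subset_uIcc hy)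

theorem norm_hankelKernel_le (s : ℂ) (x : ℝ) {b₁ b₂ y c : ℝ} (hy : y ∈ [[b₁, b₂]])
    (hc : Real.cos y ≤ c) :
    ‖hankelKernel s (x + y * Complex.I)‖ ≤
      Real.exp (Real.exp x * c + (1 - s.re) * x + |s.im| * (|b₁| + |b₂|)) := by
  rw [norm_hankelKernel]
  have h₁ : |y| ≤ |b₁| + |b₂| := by
    rw [abs_le]
    rcases mem_uIcc.1 hy with h | h <;> constructor <;>
      linarith [neg_abs_le b₁, neg_abs_le b₂, le_abs_self b₁, le_abs_self b₂,
        abs_nonneg b₁, abs_nonneg b₂]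
  have h₂ : s.im * y ≤ |s.im| * (|b₁| + |b₂|) :=
    (le_abs_self _).trans (by rw [abs_mul]; gcongr)
  gcongr

theorem integrable_hankelKernel_mul {s : ℂ} {b C : ℝ} {g : ℂ → ℂ} (hs : s.re < 1)
    (hb : Real.cos b < 0) (hg : Continuous fun x : ℝ ↦ g (x + b * Complex.I))
    (hC : ∀ x : ℝ, ‖g (x + b * Complex.I)‖ ≤ C) :
    Integrable fun x : ℝ ↦ hankelKernel s (x + b * Complex.I) * g (x + b * Complex.I) :=
  (integrable_hankelKernel hs hb).mul_bdd hg.aestronglyMeasurable (ae_of_all _ hC)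

/-- If the integrand is controlled by a Hankel kernel with `s.re < 1`, the vertical segment of the
contour may be moved to `-∞`. -/
theorem hankelIntegral_eq_integral {s : ℂ} {b₁ b₂ C : ℝ} {g : ℂ → ℂ} (hs : s.re < 1)
    (hb₁ : Real.cos b₁ < 0) (hb₂ : Real.cos b₂ < 0)
    (hg : DifferentiableOn ℂ g {v | v.im ∈ [[b₁, b₂]]})
    (hC : ∀ v : ℂ, v.im ∈ [[b₁, b₂]] → ‖g v‖ ≤ C) (X : ℝ) :
    hankelIntegral b₁ b₂ X (fun v ↦ hankelKernel s v * g v) =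
      ∫ x : ℝ, (hankelKernel s (x + b₂ * Complex.I) * g (x + b₂ * Complex.I) -
        hankelKernel s (x + b₁ * Complex.I) * g (x + b₁ * Complex.I)) := by
  set F : ℂ → ℂ := fun v ↦ hankelKernel s v * g v with hFdef
  have hF : DifferentiableOn ℂ F {v | v.im ∈ [[b₁, b₂]]} :=
    (differentiable_hankelKernel s).differentiableOn.mul hg
  have hint : ∀ b ∈ [[b₁, b₂]], Real.cos b < 0 →
      Integrable fun x : ℝ ↦ F (x + b * Complex.I) := fun b hb hcos ↦
    integrable_hankelKernel_mul hs hcos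
      (hg.continuousOn.comp_continuous (by fun_prop) fun x ↦ by simpa using hb)
      fun x ↦ hC _ (by simpa using hb)
  have hD : Integrable fun x : ℝ ↦ F (x + b₂ * Complex.I) - F (x + b₁ * Complex.I) :=
    (hint _ right_mem_uIcc hb₂).sub (hint _ left_mem_uIcc hb₁)
  have hB : Tendsto (fun x ↦
      Real.exp (Real.exp x * 1 + (1 - s.re) * x + |s.im| * (|b₁| + |b₂|)) * C) atBot (𝓝 0) := by
    rw [← zero_mul C]
    refine (Real.tendsto_exp_atBot.comp ?_).mul_const C
    refine Tendsto.atBot_add ?_ tendsto_const_nhds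
    exact (Real.tendsto_exp_atBot.mul_const 1).add_atBot
      (tendsto_id.const_mul_atBot (by linarith))
  have hleft := tendsto_vertical_integral_zero (F := F) (b₁ := b₁) (b₂ := b₂) hB fun x y hy ↦ by
    rw [hFdef, norm_mul]
    gcongr
    · exact norm_hankelKernel_le s x hy (Real.cos_le_one y)
    · exact hC _ (by simpa using hy)
  have hlim := intervalIntegral_tendsto_integral_Iic X hD.integrableOn tendsto_id
  simp only [id, intervalIntegral_sub_eq_of_differentiableOn_strip hF] at hlim
  have hIic := tendsto_nhds_unique hlim (hleft.const_sub _)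
  rw [sub_zero] at hIic
  rw [hankelIntegral, ← hIic, add_comm]
  simpa using integral_add_compl measurableSet_Iic hD

theorem integral_hankelKernel_eq_of_cos_le {s : ℂ} {b₁ b₂ c : ℝ} (hs : s.re < 1) (hc : c < 0)
    (hcos : ∀ y ∈ [[b₁, b₂]], Real.cos y ≤ c) :
    ∫ x : ℝ, hankelKernel s (x + b₂ * Complex.I) =
      ∫ x : ℝ, hankelKernel s (x + b₁ * Complex.I) := by
  have h₁ := integrable_hankelKernel hs ((hcos _ left_mem_uIcc).trans_lt hc)
  have h₂ := integrable_hankelKernel hs ((hcos _ right_mem_uIcc).trans_lt hc)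
  rw [← sub_eq_zero, ← integral_sub h₂ h₁]
  have hleft : Tendsto (fun x ↦
      Real.exp (Real.exp x * c + (1 - s.re) * x + |s.im| * (|b₁| + |b₂|))) atBot (𝓝 0) := by
    refine Real.tendsto_exp_atBot.comp (Tendsto.atBot_add ?_ tendsto_const_nhds)
    exact (Real.tendsto_exp_atBot.mul_const c).add_atBot
      (tendsto_id.const_mul_atBot (by linarith))
  have hright : Tendsto (fun x ↦
      Real.exp (Real.exp x * c + (1 - s.re) * x + |s.im| * (|b₁| + |b₂|))) atTop (𝓝 0) := by
    refine Real.tendsto_exp_atBot.comp (Tendsto.atBot_add ?_ tendsto_const_nhds)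
    have h : Tendsto (fun x ↦ Real.exp x * (c + (1 - s.re) * (x * Real.exp (-x)))) atTop atBot := by
      refine Real.tendsto_exp_atTop.atTop_mul_neg hc ?_
      simpa using ((Real.tendsto_pow_mul_exp_neg_atTop_nhds_zero 1).const_mul
        (1 - s.re)).const_add c
    refine h.congr fun x ↦ ?_
    have : Real.exp x * Real.exp (-x) = 1 := by rw [← Real.exp_add]; simp
    linear_combination (1 - s.re) * x * this
  have hbd : ∀ x : ℝ, ∀ y ∈ [[b₁, b₂]], ‖hankelKernel s (x + y * Complex.I)‖ ≤
      Real.exp (Real.exp x * c + (1 - s.re) * x + |s.im| * (|b₁| + |b₂|)) :=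
    fun x y hy ↦ norm_hankelKernel_le s x hy (hcos y hy)
  have hlim := intervalIntegral_tendsto_integral (h₂.sub h₁) tendsto_neg_atTop_atBot tendsto_id
  refine tendsto_nhds_unique hlim ?_
  have h := (tendsto_vertical_integral_zero hright hbd).sub
    ((tendsto_vertical_integral_zero hleft hbd).comp tendsto_neg_atTop_atBot)
  rw [sub_zero] at h
  refine h.congr fun X ↦ ?_
  rw [id, Function.comp_apply]
  exact (intervalIntegral_sub_eq_of_differentiableOn_strip
    (differentiable_hankelKernel s).differentiableOn _ _).symm

theorem cos_le_cos_of_mem_uIcc_pi {b y : ℝ} (h₀ : 0 ≤ b) (h₁ : b ≤ 2 * π) (hy : y ∈ [[π, b]]) :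
    Real.cos y ≤ Real.cos b := by
  rcases mem_uIcc.1 hy with h | h
  · rw [← Real.cos_two_pi_sub y, ← Real.cos_two_pi_sub b]
    exact Real.cos_le_cos_of_nonneg_of_le_pi (by linarith) (by linarith) (by linarith)
  · exact Real.cos_le_cos_of_nonneg_of_le_pi h₀ h.2 h.1

theorem cos_neg_of_mem_Ioo {b : ℝ} (hb : b ∈ Ioo (π / 2) (3 * π / 2)) : Real.cos b < 0 :=
  Real.cos_neg_of_pi_div_two_lt_of_lt hb.1 (by linarith [hb.2])

theorem integral_hankelKernel_of_exp_eq_neg_one {s : ℂ} {σ : ℝ} (hs : s.re < 1)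
    (hσ : Complex.exp (σ * Complex.I) = -1) :
    ∫ x : ℝ, hankelKernel s (x + σ * Complex.I) =
      Complex.exp ((1 - s) * (σ * Complex.I)) * Complex.Gamma (1 - s) := by
  rw [Complex.Gamma_eq_integral (by simpa using hs), Complex.GammaIntegral, ← integral_comp_exp,
    ← MeasureTheory.integral_const_mul]
  congr 1 with x
  have hx : (Real.exp x : ℂ) ≠ 0 := Complex.ofReal_ne_zero.2 (Real.exp_ne_zero x)
  rw [hankelKernel, Complex.exp_add (x : ℂ), hσ, Complex.cpow_def_of_ne_zero hx,
    ← Complex.ofReal_log (Real.exp_pos x).le, Real.log_exp, Complex.real_smul]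
  push_cast
  rw [← Complex.exp_add, ← Complex.exp_add, ← Complex.exp_add]
  ring_nf

theorem integral_hankelKernel_upper {s : ℂ} {b : ℝ} (hs : s.re < 1)
    (hb : b ∈ Ioo (π / 2) (3 * π / 2)) :
    ∫ x : ℝ, hankelKernel s (x + b * Complex.I) =
      Complex.exp ((1 - s) * (π * Complex.I)) * Complex.Gamma (1 - s) := by
  rw [← integral_hankelKernel_of_exp_eq_neg_one hs Complex.exp_pi_mul_I]
  exact integral_hankelKernel_eq_of_cos_le hs (cos_neg_of_mem_Ioo hb) fun y hy ↦
    cos_le_cos_of_mem_uIcc_pi (by linarith [hb.1, Real.pi_pos]) (by linarith [hb.2, Real.pi_pos]) hy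

theorem integral_hankelKernel_lower {s : ℂ} {b : ℝ} (hs : s.re < 1)
    (hb : -b ∈ Ioo (π / 2) (3 * π / 2)) :
    ∫ x : ℝ, hankelKernel s (x + b * Complex.I) =
      Complex.exp (-((1 - s) * (π * Complex.I))) * Complex.Gamma (1 - s) := by
  have h := integral_hankelKernel_of_exp_eq_neg_one (σ := -π) hs (by simp [Complex.exp_neg])
  rw [show (1 - s) * ((-π : ℝ) * Complex.I) = -((1 - s) * (π * Complex.I)) by push_cast; ring] at h
  rw [← h]
  refine integral_hankelKernel_eq_of_cos_le hs (cos_neg_of_mem_Ioo hb) fun y hy ↦ ?_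
  rw [← Real.cos_neg y]
  refine cos_le_cos_of_mem_uIcc_pi (by linarith [hb.1, Real.pi_pos])
    (by linarith [hb.2, Real.pi_pos]) ?_
  rw [mem_uIcc] at hy ⊢
  rcases hy with h | h
  · exact Or.inr ⟨by linarith [h.2], by linarith [h.1]⟩
  · exact Or.inl ⟨by linarith [h.2], by linarith [h.1]⟩

theorem hankelIntegral_hankelKernel_of_re_lt_one {s : ℂ} {b₁ b₂ : ℝ}
    (hb₁ : -b₁ ∈ Ioo (π / 2) (3 * π / 2)) (hb₂ : b₂ ∈ Ioo (π / 2) (3 * π / 2))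
    (hs : s.re < 1) (hs' : ∀ n : ℤ, s ≠ n) (X : ℝ) :
    hankelIntegral b₁ b₂ X (hankelKernel s) =
      2 * π * Complex.I * (Complex.Gamma s)⁻¹ := by
  have hcos₁ : Real.cos b₁ < 0 := by simpa using cos_neg_of_mem_Ioo hb₁
  have hcos₂ := cos_neg_of_mem_Ioo hb₂
  have h := hankelIntegral_eq_integral (g := fun _ ↦ 1) (C := 1) hs hcos₁ hcos₂
    (differentiableOn_const _) (by simp) X
  simp only [mul_one] at h
  rw [h, integral_sub (integrable_hankelKernel hs hcos₂) (integrable_hankelKernel hs hcos₁),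
    integral_hankelKernel_upper hs hb₂, integral_hankelKernel_lower hs hb₁]
  have hπ : (π : ℂ) ≠ 0 := Complex.ofReal_ne_zero.2 Real.pi_ne_zero
  have hsin : Complex.sin (π * s) ≠ 0 := by
    rw [Ne, Complex.sin_eq_zero_iff]
    rintro ⟨k, hk⟩
    exact hs' k (mul_left_cancel₀ hπ (by rw [hk, mul_comm]))
  have hrefl := Complex.Gamma_mul_Gamma_one_sub s
  have hΓ : Complex.Gamma s ≠ 0 := left_ne_zero_of_mul (hrefl ▸ div_ne_zero hπ hsin)
  rw [eq_div_iff hsin] at hrefl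
  have hsin' : Complex.exp ((1 - s) * (π * Complex.I)) - Complex.exp (-((1 - s) * (π * Complex.I)))
      = 2 * Complex.I * Complex.sin (π * s) := by
    have : Complex.sin (π * s) = Complex.sin (π * (1 - s)) := by
      rw [mul_sub, mul_one, Complex.sin_pi_sub]
    rw [this, Complex.sin]
    ring_nf
    rw [Complex.I_sq]
    ring
  rw [← sub_mul, hsin', eq_mul_inv_iff_mul_eq₀ hΓ]
  linear_combination 2 * Complex.I * hrefl

theorem hankelIntegral_hankelKernel_eq_mul (s : ℂ) {b₁ b₂ : ℝ} (hb₁ : Real.cos b₁ < 0)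
    (hb₂ : Real.cos b₂ < 0) (X : ℝ) :
    hankelIntegral b₁ b₂ X (hankelKernel s) =
      s * hankelIntegral b₁ b₂ X (hankelKernel (s + 1)) := by
  have hline : ∀ b : ℝ, Real.cos b < 0 →
      ((∫ x : ℝ in Ioi X, hankelKernel s (x + b * Complex.I)) -
        s * ∫ x : ℝ in Ioi X, hankelKernel (s + 1) (x + b * Complex.I)) =
          -hankelKernel (s + 1) (X + b * Complex.I) := fun b hb ↦ by
    have hi := integrableOn_hankelKernel s X hb
    have hi' := integrableOn_hankelKernel (s + 1) X hb
    have hd : ∀ x : ℝ, HasDerivAt (fun x : ℝ ↦ hankelKernel (s + 1) (x + b * Complex.I))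
        (hankelKernel s (x + b * Complex.I) - s * hankelKernel (s + 1) (x + b * Complex.I)) x :=
      fun x ↦ by
        have h := (hasDerivAt_hankelKernel s (x + b * Complex.I)).comp x
          ((hasDerivAt_id x).ofReal_comp.add_const (b * Complex.I))
        exact h.congr_deriv (by simp)
    have hint := hi.sub (hi'.const_mul s)
    rw [← MeasureTheory.integral_const_mul, ← integral_sub hi (hi'.const_mul s), ← zero_sub]
    exact integral_Ioi_of_hasDerivAt_of_tendsto' (fun x _ ↦ hd x) hint
      (tendsto_zero_of_hasDerivAt_of_integrableOn_Ioi (fun x _ ↦ hd x) hint hi')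
  have hvert : Complex.I * ((∫ y in b₁..b₂, hankelKernel s (X + y * Complex.I)) -
      s * ∫ y in b₁..b₂, hankelKernel (s + 1) (X + y * Complex.I)) =
        hankelKernel (s + 1) (X + b₂ * Complex.I) - hankelKernel (s + 1) (X + b₁ * Complex.I) := by
    have hc : ∀ s : ℂ, Continuous fun y : ℝ ↦ hankelKernel s (X + y * Complex.I) := fun s ↦ by
      fun_prop
    have hd : ∀ y : ℝ, HasDerivAt (fun y : ℝ ↦ hankelKernel (s + 1) (X + y * Complex.I))
        (Complex.I * (hankelKernel s (X + y * Complex.I) -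
          s * hankelKernel (s + 1) (X + y * Complex.I))) y := fun y ↦ by
      have h := (hasDerivAt_hankelKernel s (X + y * Complex.I)).comp y
        (((hasDerivAt_id y).ofReal_comp.mul_const Complex.I).const_add (X : ℂ))
      exact h.congr_deriv (by simp [mul_comm])
    rw [← intervalIntegral.integral_const_mul, ← intervalIntegral.integral_sub
      ((hc s).intervalIntegrable _ _) (((hc _).const_mul s).intervalIntegrable _ _),
      ← intervalIntegral.integral_const_mul]
    exact intervalIntegral.integral_eq_sub_of_hasDerivAt (fun y _ ↦ hd y)
      (Continuous.intervalIntegrable (by fun_prop) _ _)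
  rw [hankelIntegral, hankelIntegral,
    integral_sub (integrableOn_hankelKernel s X hb₂) (integrableOn_hankelKernel s X hb₁),
    integral_sub (integrableOn_hankelKernel _ X hb₂) (integrableOn_hankelKernel _ X hb₁)]
  linear_combination hline b₂ hb₂ - hline b₁ hb₁ + hvert

theorem continuous_integral_hankelKernel {X b : ℝ} (hX : 0 ≤ X) (hb : Real.cos b < 0) :
    Continuous fun s ↦ ∫ x : ℝ in Ioi X, hankelKernel s (x + b * Complex.I) := by
  refine continuous_iff_continuousAt.2 fun s₀ ↦ ?_
  refine continuousAt_of_dominated (bound := fun x ↦ Real.exp ((|s₀.im| + 1) * |b|) *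
      ‖hankelKernel ((s₀.re - 1 : ℝ) : ℂ) (x + b * Complex.I)‖)
    (.of_forall fun s ↦ by fun_prop) ?_
    ((integrableOn_hankelKernel _ X hb).norm.const_mul _)
    (ae_of_all _ fun x ↦ Continuous.continuousAt
      (continuous_hankelKernel_uncurry.comp (by fun_prop : Continuous fun s : ℂ ↦
        (s, (x : ℂ) + b * Complex.I))))
  filter_upwards [Metric.ball_mem_nhds s₀ one_pos] with s hs
  filter_upwards [ae_restrict_mem measurableSet_Ioi] with x hx
  have hx₀ : 0 ≤ x := hX.trans (le_of_lt hx)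
  rw [Metric.mem_ball, Complex.dist_eq] at hs
  have hre := (Complex.abs_re_le_norm (s - s₀)).trans hs.le
  have him := (Complex.abs_im_le_norm (s - s₀)).trans hs.le
  rw [Complex.sub_re] at hre
  rw [Complex.sub_im] at him
  rw [norm_hankelKernel, norm_hankelKernel, ← Real.exp_add]
  have h₁ : (1 - s.re) * x ≤ (1 - (s₀.re - 1)) * x :=
    mul_le_mul_of_nonneg_right (by linarith [(abs_le.1 hre).1]) hx₀
  have h₂ : s.im * b ≤ (|s₀.im| + 1) * |b| := by
    refine (le_abs_self _).trans ?_
    rw [abs_mul]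
    gcongr
    linarith [abs_sub_abs_le_abs_sub s.im s₀.im]
  refine Real.exp_le_exp.2 ?_
  rw [Complex.ofReal_re, Complex.ofReal_im]
  linarith

/-- Hankel's formula for the reciprocal Gamma function. -/
theorem hankelIntegral_hankelKernel (s : ℂ) {b₁ b₂ X : ℝ}
    (hb₁ : -b₁ ∈ Ioo (π / 2) (3 * π / 2)) (hb₂ : b₂ ∈ Ioo (π / 2) (3 * π / 2)) (hX : 0 ≤ X) :
    hankelIntegral b₁ b₂ X (hankelKernel s) = 2 * π * Complex.I * (Complex.Gamma s)⁻¹ := by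
  have hcos₁ : Real.cos b₁ < 0 := by simpa using cos_neg_of_mem_Ioo hb₁
  have hcos₂ := cos_neg_of_mem_Ioo hb₂
  have hstep : ∀ n : ℕ, ∀ s : ℂ, s.re < n + 1 → (∀ k : ℤ, s ≠ k) →
      hankelIntegral b₁ b₂ X (hankelKernel s) = 2 * π * Complex.I * (Complex.Gamma s)⁻¹ := by
    intro n
    induction n with
    | zero =>
      exact fun s hs hs' ↦ hankelIntegral_hankelKernel_of_re_lt_one hb₁ hb₂ (by simpa using hs) hs' X
    | succ n ih =>
      intro s hs hs'
      have h := ih (s - 1) (by simp at hs ⊢; linarith) fun k hk ↦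
        hs' (k + 1) (by push_cast; rw [← hk]; ring)
      have hne : s - 1 ≠ 0 := sub_ne_zero.2 (by simpa using hs' 1)
      rw [hankelIntegral_hankelKernel_eq_mul _ hcos₁ hcos₂,
        Complex.one_div_Gamma_eq_self_mul_one_div_Gamma_add_one, sub_add_cancel] at h
      exact mul_left_cancel₀ hne (by rw [h]; ring)
  refine congrFun (Continuous.ext_on (f := fun s ↦ hankelIntegral b₁ b₂ X (hankelKernel s))
    (g := fun s ↦ 2 * π * Complex.I * (Complex.Gamma s)⁻¹)
    ((countable_range fun k : ℤ ↦ (k : ℂ)).dense_compl ℝ) ?_ ?_ fun s hs ↦ ?_) s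
  · have h := ((continuous_integral_hankelKernel hX hcos₂).sub
      (continuous_integral_hankelKernel hX hcos₁)).add
      (continuous_const.mul (intervalIntegral.continuous_parametric_intervalIntegral_of_continuous'
        (f := fun s (y : ℝ) ↦ hankelKernel s (X + y * Complex.I)) (μ := volume)
        (continuous_hankelKernel_uncurry.comp (by fun_prop : Continuous fun p : ℂ × ℝ ↦
          (p.1, (X : ℂ) + p.2 * Complex.I))) b₁ b₂) : Continuous fun s ↦ Complex.I * _)
    refine h.congr fun s ↦ ?_
    rw [hankelIntegral, integral_sub (integrableOn_hankelKernel s X hcos₂)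
      (integrableOn_hankelKernel s X hcos₁)]
    rfl
  · exact continuous_const.mul Complex.differentiable_one_div_Gamma.continuous
  · obtain ⟨n, hn⟩ := exists_nat_gt s.re
    exact hstep n s (by linarith) fun k hk ↦ hs ⟨k, hk.symm⟩

theorem hasSum_mul_hankelKernel {ρ : ℝ} {z v : ℂ} (μ : ℂ)
    (hz : ‖z * Complex.exp (-(v / ρ))‖ < 1) :
    HasSum (fun k : ℕ ↦ z ^ k * hankelKernel (μ + k / ρ) v)
      (hankelKernel (μ - 1 / ρ) v * (Complex.exp (v / ρ) - z)⁻¹) := by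
  have h := (hasSum_geometric_of_norm_lt_one hz).mul_left (hankelKernel μ v)
  have hk : ∀ k : ℕ, hankelKernel μ v * (z * Complex.exp (-(v / ρ))) ^ k =
      z ^ k * hankelKernel (μ + k / ρ) v := fun k ↦ by
    rw [hankelKernel_add, mul_pow, ← Complex.exp_nat_mul]
    ring_nf
  have hlim : hankelKernel μ v * (1 - z * Complex.exp (-(v / ρ)))⁻¹ =
      hankelKernel (μ - 1 / ρ) v * (Complex.exp (v / ρ) - z)⁻¹ := by
    rw [sub_eq_add_neg μ, hankelKernel_add,
      show Complex.exp (v / ρ) - z =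
        Complex.exp (v / ρ) * (1 - z * Complex.exp (-(v / ρ))) by
          rw [Complex.exp_neg]; field_simp,
      show -(-(1 / (ρ : ℂ)) * v) = v / ρ by ring, mul_inv]
    field_simp
  rw [hlim] at h
  exact h.congr_fun fun k ↦ (hk k).symm

theorem norm_mul_hankelKernel (ρ : ℝ) (μ z v : ℂ) (k : ℕ) :
    ‖z ^ k * hankelKernel (μ + k / ρ) v‖ =
      (‖z‖ * Real.exp (-(v.re / ρ))) ^ k * ‖hankelKernel μ v‖ := by
  rw [hankelKernel_add, norm_mul, norm_mul, norm_pow, mul_pow, ← Real.exp_nat_mul,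
    Complex.norm_exp]
  have : (-((k : ℂ) / ρ * v)).re = k * -(v.re / ρ) := by
    rw [show -((k : ℂ) / ρ * v) = ((-(k / ρ) : ℝ) : ℂ) * v by push_cast; ring,
      Complex.re_ofReal_mul]
    ring
  rw [this]
  ring

theorem hasSum_mul_hankelIntegral {ρ b₁ b₂ X : ℝ} {z : ℂ} (μ : ℂ) (hρ : 0 < ρ)
    (hb₁ : Real.cos b₁ < 0) (hb₂ : Real.cos b₂ < 0) (hX : ‖z‖ * Real.exp (-(X / ρ)) < 1) :
    HasSum (fun k : ℕ ↦ z ^ k * hankelIntegral b₁ b₂ X (hankelKernel (μ + k / ρ)))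
      (hankelIntegral b₁ b₂ X
        fun v ↦ hankelKernel (μ - 1 / ρ) v * (Complex.exp (v / ρ) - z)⁻¹) := by
  set q := ‖z‖ * Real.exp (-(X / ρ)) with hq
  have hq₀ : 0 ≤ q := by positivity
  have hle : ∀ v : ℂ, X ≤ v.re → ‖z‖ * Real.exp (-(v.re / ρ)) ≤ q := fun v hv ↦ by
    rw [hq]
    gcongr
  have hsum : ∀ v : ℂ, X ≤ v.re → HasSum (fun k : ℕ ↦ z ^ k * hankelKernel (μ + k / ρ) v)
      (hankelKernel (μ - 1 / ρ) v * (Complex.exp (v / ρ) - z)⁻¹) := fun v hv ↦ by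
    refine hasSum_mul_hankelKernel μ (lt_of_eq_of_lt ?_ ((hle v hv).trans_lt hX))
    rw [norm_mul, Complex.norm_exp, Complex.neg_re, Complex.div_ofReal_re]
  have hbd : ∀ v : ℂ, X ≤ v.re → ∀ k : ℕ,
      ‖z ^ k * hankelKernel (μ + k / ρ) v‖ ≤ q ^ k * ‖hankelKernel μ v‖ := fun v hv k ↦ by
    rw [norm_mul_hankelKernel]
    gcongr
    exact hle v hv
  have hgeom := summable_geometric_of_lt_one hq₀ hX
  have h₁ := hasSum_integral_of_dominated_convergence (μ := volume.restrict (Ioi X))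
    (F := fun (k : ℕ) (x : ℝ) ↦ z ^ k * hankelKernel (μ + k / ρ) (x + b₂ * Complex.I) -
      z ^ k * hankelKernel (μ + k / ρ) (x + b₁ * Complex.I))
    (f := fun x : ℝ ↦ hankelKernel (μ - 1 / ρ) (x + b₂ * Complex.I) *
        (Complex.exp ((x + b₂ * Complex.I) / ρ) - z)⁻¹ -
      hankelKernel (μ - 1 / ρ) (x + b₁ * Complex.I) *
        (Complex.exp ((x + b₁ * Complex.I) / ρ) - z)⁻¹)
    (fun k x ↦ q ^ k * (‖hankelKernel μ (x + b₂ * Complex.I)‖ +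
      ‖hankelKernel μ (x + b₁ * Complex.I)‖))
    (fun k ↦ by fun_prop)
    (fun k ↦ by
      filter_upwards [ae_restrict_mem measurableSet_Ioi] with x hx
      rw [mul_add]
      exact (norm_sub_le _ _).trans (add_le_add
        (hbd _ (by simpa using le_of_lt hx) k) (hbd _ (by simpa using le_of_lt hx) k)))
    (ae_of_all _ fun x ↦ hgeom.mul_right _)
    (by
      simp only [tsum_mul_right]
      exact ((integrableOn_hankelKernel μ X hb₂).norm.add
        (integrableOn_hankelKernel μ X hb₁).norm).const_mul _)
    (by
      filter_upwards [ae_restrict_mem measurableSet_Ioi] with x hx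
      exact (hsum _ (by simpa using le_of_lt hx)).sub (hsum _ (by simpa using le_of_lt hx)))
  have h₂ := intervalIntegral.hasSum_integral_of_dominated_convergence (a := b₁) (b := b₂)
    (μ := volume)
    (F := fun (k : ℕ) (y : ℝ) ↦ z ^ k * hankelKernel (μ + k / ρ) (X + y * Complex.I))
    (f := fun y : ℝ ↦ hankelKernel (μ - 1 / ρ) (X + y * Complex.I) *
        (Complex.exp ((X + y * Complex.I) / ρ) - z)⁻¹)
    (fun k y ↦ q ^ k * ‖hankelKernel μ (X + y * Complex.I)‖)
    (fun k ↦ by fun_prop)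
    (fun k ↦ ae_of_all _ fun y _ ↦ hbd _ (by simp) k)
    (ae_of_all _ fun y _ ↦ hgeom.mul_right _)
    (by
      simp only [tsum_mul_right]
      exact Continuous.intervalIntegrable (by fun_prop) _ _)
    (ae_of_all _ fun y _ ↦ hsum _ (by simp))
  refine (h₁.add (h₂.mul_left Complex.I)).congr_fun fun k ↦ ?_
  simp only [← mul_sub]
  rw [hankelIntegral, MeasureTheory.integral_const_mul, intervalIntegral.integral_const_mul]
  ring

end HankelContour

theorem neg_one_lt_cos {ω : ℝ} (hω : |ω| < π) : -1 < Real.cos ω := by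
  rw [← Real.cos_pi, ← Real.cos_abs ω]
  exact Real.cos_lt_cos_of_nonneg_of_le_pi (abs_nonneg _) le_rfl hω

theorem sq_mul_le_normSq_mul_exp_add {ω c t R : ℝ} (ht : 0 ≤ t) (hR : 0 ≤ R)
    (hc : -1 ≤ c) (hω : c ≤ Real.cos ω) :
    R ^ 2 * ((1 + c) / 2) ≤ Complex.normSq (t * Complex.exp (ω * Complex.I) + R) := by
  have h : Complex.normSq (t * Complex.exp (ω * Complex.I) + R) =
      t ^ 2 + 2 * t * R * Real.cos ω + R ^ 2 := by
    rw [Complex.normSq_apply]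
    simp [Complex.exp_ofReal_mul_I_re, Complex.exp_ofReal_mul_I_im]
    linear_combination t ^ 2 * Real.sin_sq_add_cos_sq ω
  rw [h]
  nlinarith [mul_le_mul_of_nonneg_left hω (mul_nonneg ht hR),
    mul_nonneg (sub_nonneg.2 (hω.trans (Real.cos_le_one ω))) (sq_nonneg (t - R)),
    mul_nonneg (by linarith : 0 ≤ 1 + c) (sq_nonneg t),
    mul_nonneg (by linarith : 0 ≤ 1 + c) (mul_nonneg ht hR)]

theorem exp_div_sub_eq {ρ R θ ω : ℝ} {v : ℂ} (hρ : ρ ≠ 0) (hv : v.im = ρ * (θ - π + ω)) :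
    Complex.exp (v / ρ) - R * Complex.exp (Complex.I * θ) =
      -(Complex.exp (θ * Complex.I) *
        ((Real.exp (v.re / ρ) : ℂ) * Complex.exp (ω * Complex.I) + R)) := by
  have hρ' : (ρ : ℂ) ≠ 0 := Complex.ofReal_ne_zero.2 hρ
  have h : v / ρ = ((v.re / ρ : ℝ) : ℂ) + (θ * Complex.I + ω * Complex.I) - π * Complex.I := by
    rw [← Complex.re_add_im v, hv]
    push_cast
    field_simp
    simp
    ring
  rw [h, Complex.exp_sub, Complex.exp_pi_mul_I, Complex.exp_add, Complex.exp_add,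
    Complex.ofReal_exp, mul_comm Complex.I]
  ring

theorem AF_mul_eq (ρ : ℝ) (μ : ℂ) (R θ r ω ω' : ℝ) :
    Complex.exp ((ρ : ℂ) * (1 - μ) * ((Real.log (R * r) : ℂ) + Complex.I * (θ : ℂ))) *
      Complex.exp (-(Complex.I * (ρ : ℂ) * (π : ℂ) * (1 - μ))) * AF ρ μ R θ r ω ω' =
    ((r ^ 2 + 2 * r * Real.cos ω' + 1 : ℝ) : ℂ) *
      hankelKernel μ ((ρ * Real.log (R * r) : ℝ) + (ρ * (θ - π + ω) : ℝ) * Complex.I) *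
      (r + Complex.exp (Complex.I * ω)) := by
  have hexp : Complex.exp ((ρ * Real.log (R * r) : ℝ) + (ρ * (θ - π + ω) : ℝ) * Complex.I) =
      Complex.exp ((ρ : ℂ) * ((Real.log (R * r) : ℂ) + Complex.I * ((θ - π : ℝ) : ℂ))) *
        (Complex.cos (ρ * ω) + Complex.sin (ρ * ω) * Complex.I) := by
    rw [← Complex.exp_mul_I, ← Complex.exp_add]
    push_cast
    ring_nf
  rw [AF, etaF, hankelKernel, hexp]
  generalize Complex.exp ((ρ : ℂ) * ((Real.log (R * r) : ℂ) + Complex.I * ((θ - π : ℝ) : ℂ))) = E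
  have h : ∀ a b c d e D P : ℂ, a + b + c + d = e →
      Complex.exp a * Complex.exp b * (Complex.exp c * D * Complex.exp d * P) =
        D * Complex.exp e * P := fun a b c d e D P he ↦ by
    rw [← he, Complex.exp_add, Complex.exp_add, Complex.exp_add]
    ring
  refine h _ _ _ _ _ _ _ ?_
  push_cast
  ring

theorem KF_eq {ρ : ℝ} {μ : ℂ} {R θ r φ₁ φ₂ : ℝ} (hR : 0 < R) (hr : 0 < r) (hρ : ρ ≠ 0)
    (h₁ : |φ₁| < π) (h₂ : |φ₂| < π) :
    KF ρ μ R θ r φ₁ φ₂ = ρ / (2 * π * Complex.I) / r *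
      (hankelKernel (μ - 1 / ρ)
          ((ρ * Real.log (R * r) : ℝ) + (ρ * (θ - π + φ₂) : ℝ) * Complex.I) *
        (Complex.exp (((ρ * Real.log (R * r) : ℝ) + (ρ * (θ - π + φ₂) : ℝ) * Complex.I) / ρ) -
          R * Complex.exp (Complex.I * θ))⁻¹ -
      hankelKernel (μ - 1 / ρ)
          ((ρ * Real.log (R * r) : ℝ) + (ρ * (θ - π + φ₁) : ℝ) * Complex.I) *
        (Complex.exp (((ρ * Real.log (R * r) : ℝ) + (ρ * (θ - π + φ₁) : ℝ) * Complex.I) / ρ) -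
          R * Complex.exp (Complex.I * θ))⁻¹) := by
  have hr' : (r : ℂ) ≠ 0 := Complex.ofReal_ne_zero.2 hr.ne'
  have hR' : (R : ℂ) ≠ 0 := Complex.ofReal_ne_zero.2 hR.ne'
  have hden : ∀ ω : ℝ, ((r ^ 2 + 2 * r * Real.cos ω + 1 : ℝ) : ℂ) =
      (r * Complex.exp (ω * Complex.I) + 1) * (r + Complex.exp (ω * Complex.I)) *
        Complex.exp (-(ω * Complex.I)) := fun ω ↦ by
    have he : Complex.exp (ω * Complex.I) * Complex.exp (-(ω * Complex.I)) = 1 := by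
      rw [← Complex.exp_add]; simp
    push_cast
    rw [Complex.cos, neg_mul]
    linear_combination
      (-r ^ 2 - 1 - r * Complex.exp (ω * Complex.I)) * he
  have hne : ∀ ω : ℝ, |ω| < π → ((r ^ 2 + 2 * r * Real.cos ω + 1 : ℝ) : ℂ) ≠ 0 := fun ω hω ↦ by
    have := neg_one_lt_cos hω
    refine Complex.ofReal_ne_zero.2 (ne_of_gt ?_)
    nlinarith [sq_nonneg (r - 1), mul_pos hr (by linarith : 0 < 1 + Real.cos ω)]
  have hkey : ∀ ω : ℝ, |ω| < π →
      hankelKernel (μ - 1 / ρ)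
          ((ρ * Real.log (R * r) : ℝ) + (ρ * (θ - π + ω) : ℝ) * Complex.I) *
        (Complex.exp (((ρ * Real.log (R * r) : ℝ) + (ρ * (θ - π + ω) : ℝ) * Complex.I) / ρ) -
          R * Complex.exp (Complex.I * θ))⁻¹ =
      r * (hankelKernel μ ((ρ * Real.log (R * r) : ℝ) + (ρ * (θ - π + ω) : ℝ) * Complex.I) *
        (r + Complex.exp (Complex.I * ω)) / ((r ^ 2 + 2 * r * Real.cos ω + 1 : ℝ) : ℂ)) := by
    intro ω hω
    set v : ℂ := (ρ * Real.log (R * r) : ℝ) + (ρ * (θ - π + ω) : ℝ) * Complex.I with hv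
    have hre : Real.exp (v.re / ρ) = R * r := by
      rw [hv]
      simp only [Complex.add_re, Complex.ofReal_re, Complex.re_ofReal_mul, Complex.I_re, mul_zero,
        add_zero]
      rw [mul_div_cancel_left₀ _ hρ, Real.exp_log (mul_pos hR hr)]
    have hsub := exp_div_sub_eq (v := v) (R := R) (ω := ω) (θ := θ) hρ (by simp [hv])
    have hexp := exp_div_sub_eq (v := v) (R := 0) (ω := ω) (θ := θ) hρ (by simp [hv])
    rw [hre] at hsub hexp
    simp only [Complex.ofReal_zero, zero_mul, sub_zero, add_zero] at hexp
    rw [hsub, sub_eq_add_neg, hankelKernel_add,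
      show -(-(1 / (ρ : ℂ)) * v) = v / ρ by ring, hexp, mul_comm Complex.I]
    have hD := hne ω hω
    rw [hden ω] at hD ⊢
    have hD₁ := left_ne_zero_of_mul (left_ne_zero_of_mul hD)
    have hD₂ := right_ne_zero_of_mul (left_ne_zero_of_mul hD)
    rw [Complex.exp_neg]
    have he' := Complex.exp_ne_zero (θ * Complex.I)
    push_cast
    rw [show (R : ℂ) * r * Complex.exp (ω * Complex.I) + R =
        R * (r * Complex.exp (ω * Complex.I) + 1) by ring]
    generalize Complex.exp (ω * Complex.I) = w at *
    generalize Complex.exp (θ * Complex.I) = u at *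
    field_simp
  rw [hkey φ₁ h₁, hkey φ₂ h₂, KF, mul_assoc, mul_assoc, ← mul_assoc (Complex.exp _), mul_sub,
    AF_mul_eq, AF_mul_eq]
  have hD₁ := hne φ₁ h₁
  have hD₂ := hne φ₂ h₂
  generalize ((r ^ 2 + 2 * r * Real.cos φ₁ + 1 : ℝ) : ℂ) = D₁ at *
  generalize ((r ^ 2 + 2 * r * Real.cos φ₂ + 1 : ℝ) : ℂ) = D₂ at *
  field_simp

theorem integral_Ioi_eq_integral_exp_div {ρ R : ℝ} (hρ : 0 < ρ) (hR : 0 < R) (g : ℝ → ℂ) :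
    ∫ r in Set.Ioi (0 : ℝ), g r =
      ∫ x : ℝ, (Real.exp (x / ρ) / R / ρ) • g (Real.exp (x / ρ) / R) := by
  have himage : (fun x ↦ Real.exp (x / ρ) / R) '' Set.univ = Set.Ioi 0 := by
    refine Set.Subset.antisymm (by rintro _ ⟨x, -, rfl⟩; exact div_pos (Real.exp_pos _) hR)
      fun r hr ↦ ⟨ρ * Real.log (R * r), trivial, ?_⟩
    simp only
    rw [mul_div_cancel_left₀ _ hρ.ne', Real.exp_log (mul_pos hR hr), mul_div_cancel_left₀ _ hR.ne']
  have hderiv : ∀ x : ℝ, HasDerivAt (fun x ↦ Real.exp (x / ρ) / R) (Real.exp (x / ρ) / R / ρ) x :=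
    fun x ↦ ((((hasDerivAt_id x).div_const ρ).exp).div_const R).congr_deriv (by simp; ring)
  have hinj : Function.Injective fun x ↦ Real.exp (x / ρ) / R := fun x y h ↦ by
    simpa [div_left_inj' hR.ne', div_left_inj' hρ.ne'] using h
  rw [← himage, integral_image_eq_integral_abs_deriv_smul MeasurableSet.univ
    (fun x _ ↦ (hderiv x).hasDerivWithinAt) hinj.injOn, Measure.restrict_univ]
  congr 1 with x
  rw [abs_of_pos (by positivity)]

/-- Representation "B", case 1 (Theorem 3, item 1). -/
theorem mittagLeffler_repr_B_case1
    (ρ δ₁ δ₂ R θ : ℝ) (μ : ℂ)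
    (hρ : 1 / 2 < ρ) (hμ : μ.re < 1 + 1 / ρ)
    (hδ : (1 < ρ ∧ π / (2 * ρ) < δ₁ ∧ δ₁ ≤ π / ρ ∧ π / (2 * ρ) < δ₂ ∧ δ₂ ≤ π / ρ) ∨
          (ρ ≤ 1 ∧ π / (2 * ρ) < δ₁ ∧ δ₁ < π ∧ π / (2 * ρ) < δ₂ ∧ δ₂ < π))
    (hR : 0 < R)
    (hθl : π / (2 * ρ) - δ₂ + π < θ) (hθu : θ < -(π / (2 * ρ)) + δ₁ + π) :
    ML ρ μ ((R : ℂ) * Complex.exp (Complex.I * (θ : ℂ))) =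
      ∫ r in Set.Ioi (0 : ℝ), KF ρ μ R θ r (-δ₁) δ₂ := by
  have hρ₀ : 0 < ρ := by linarith
  have hπ := Real.pi_pos
  have hδ' : (0 < δ₁ ∧ δ₁ < π ∧ ρ * δ₁ ≤ π) ∧ (0 < δ₂ ∧ δ₂ < π ∧ ρ * δ₂ ≤ π) := by
    have h₀ : 0 < π / (2 * ρ) := by positivity
    rcases hδ with ⟨h, h₁, h₁', h₂, h₂'⟩ | ⟨h, h₁, h₁', h₂, h₂'⟩
    · have hlt : π / ρ < π := div_lt_self hπ h
      rw [le_div_iff₀ hρ₀, mul_comm] at h₁' h₂'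
      have := (le_div_iff₀' hρ₀).2 h₁'
      have := (le_div_iff₀' hρ₀).2 h₂'
      exact ⟨⟨by linarith, by linarith, h₁'⟩, by linarith, by linarith, h₂'⟩
    · exact ⟨⟨by linarith, h₁', by nlinarith⟩, by linarith, h₂', by nlinarith⟩
  obtain ⟨⟨hδ₁, hδ₁', hρδ₁⟩, hδ₂, hδ₂', hρδ₂⟩ := hδ'
  have hhalf : ρ * (π / (2 * ρ)) = π / 2 := by field_simp
  have hl := mul_lt_mul_of_pos_left hθl hρ₀
  have hu := mul_lt_mul_of_pos_left hθu hρ₀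
  set z : ℂ := R * Complex.exp (Complex.I * θ) with hz
  set b₁ := ρ * (θ - π + -δ₁) with hb₁
  set b₂ := ρ * (θ - π + δ₂) with hb₂
  have hmem₁ : -b₁ ∈ Set.Ioo (π / 2) (3 * π / 2) := by constructor <;> rw [hb₁] <;> linarith
  have hmem₂ : b₂ ∈ Set.Ioo (π / 2) (3 * π / 2) := by constructor <;> rw [hb₂] <;> linarith
  have hcos₁ : Real.cos b₁ < 0 := by simpa using cos_neg_of_mem_Ioo hmem₁
  have hcos₂ := cos_neg_of_mem_Ioo hmem₂
  have hs : (μ - 1 / ρ).re < 1 := by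
    rw [← Complex.ofReal_one, ← Complex.ofReal_div, Complex.sub_re, Complex.ofReal_re]
    linarith
  set c := Real.cos (max δ₁ δ₂) with hc
  have hmax : |max δ₁ δ₂| < π := by
    rw [abs_of_pos (lt_max_of_lt_left hδ₁)]
    exact max_lt hδ₁' hδ₂'
  have hc' : -1 < c := neg_one_lt_cos hmax
  have hpos : 0 < Real.sqrt (R ^ 2 * ((1 + c) / 2)) :=
    Real.sqrt_pos.2 (mul_pos (by positivity) (by linarith))
  have hlower : ∀ v : ℂ, v.im ∈ Set.uIcc b₁ b₂ →
      Real.sqrt (R ^ 2 * ((1 + c) / 2)) ≤ ‖Complex.exp (v / ρ) - z‖ := fun v hv ↦ by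
    obtain ⟨ω, hω⟩ : ∃ ω, v.im = ρ * (θ - π + ω) := ⟨v.im / ρ - (θ - π), by field_simp; ring⟩
    rw [Set.uIcc_of_le (by linarith [hmem₁.1, hmem₂.1]), Set.mem_Icc, hω, hb₁, hb₂,
      mul_le_mul_iff_right₀ hρ₀, mul_le_mul_iff_right₀ hρ₀] at hv
    have hωc : c ≤ Real.cos ω := by
      rw [hc, ← Real.cos_abs ω]
      exact Real.cos_le_cos_of_nonneg_of_le_pi (abs_nonneg ω) ((le_abs_self _).trans hmax.le)
        (abs_le.2 ⟨by linarith [le_max_left δ₁ δ₂], by linarith [le_max_right δ₁ δ₂]⟩)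
    rw [exp_div_sub_eq hρ₀.ne' hω, norm_neg, norm_mul, Complex.norm_exp_ofReal_mul_I, one_mul,
      Complex.norm_def]
    exact Real.sqrt_le_sqrt
      (sq_mul_le_normSq_mul_exp_add (Real.exp_pos _).le hR.le hc'.le hωc)
  obtain ⟨X, hX₀, hX⟩ : ∃ X : ℝ, 0 ≤ X ∧ ‖z‖ * Real.exp (-(X / ρ)) < 1 := by
    refine ⟨ρ * ‖z‖, by positivity, ?_⟩
    rw [mul_div_cancel_left₀ _ hρ₀.ne', Real.exp_neg, ← div_eq_mul_inv, div_lt_one (Real.exp_pos _)]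
    linarith [Real.add_one_le_exp ‖z‖]
  have hsum := hasSum_mul_hankelIntegral μ hρ₀ hcos₁ hcos₂ hX
  have hML : HasSum (fun k : ℕ ↦ z ^ k * (Complex.Gamma (μ + (k : ℂ) / (ρ : ℂ)))⁻¹) _ :=
    (hsum.mul_left (2 * π * Complex.I)⁻¹).congr_fun fun k ↦ by
      rw [hankelIntegral_hankelKernel _ hmem₁ hmem₂ hX₀]
      field_simp
  have hcontour := hankelIntegral_eq_integral (g := fun v ↦ (Complex.exp (v / ρ) - z)⁻¹)
    (C := (Real.sqrt (R ^ 2 * ((1 + c) / 2)))⁻¹) hs hcos₁ hcos₂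
    (DifferentiableOn.fun_inv (by fun_prop)
      fun v hv ↦ norm_pos_iff.1 (hpos.trans_le (hlower v hv)))
    (fun v hv ↦ by rw [norm_inv]; exact inv_anti₀ hpos (hlower v hv)) X
  rw [ML, hML.tsum_eq, hcontour, integral_Ioi_eq_integral_exp_div hρ₀ hR,
    ← MeasureTheory.integral_const_mul]
  congr 1 with x
  have hr : 0 < Real.exp (x / ρ) / R := by positivity
  rw [KF_eq hR hr hρ₀.ne' (by rwa [abs_neg, abs_of_pos hδ₁]) (by rwa [abs_of_pos hδ₂]),
    mul_div_cancel₀ _ hR.ne', Real.log_exp, mul_div_cancel₀ _ hρ₀.ne', ← hb₁, ← hb₂, ← hz,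
    Complex.real_smul, ← mul_assoc, Complex.ofReal_div (Real.exp (x / ρ) / R)]
  congr 1
  have hρ' : (ρ : ℂ) ≠ 0 := Complex.ofReal_ne_zero.2 hρ₀.ne'
  have hr' := Complex.ofReal_ne_zero.2 hr.ne'
  field_simp
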